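/- arXiv:2505.11068 — 3 statements merged into one kernel-verified Lean document; each statement's English description precedes it below -/
import Mathlib

section
/- Let W be a finite nonempty set, r a probability vector on W with r(w) > 0 for all w, and J : W → ℝ. Then the limit as γ_H → +∞ of [ max_{w ∈ W} ( γ_H·log r(w) + J(w) ) − γ_H·log( max_{w ∈ W} r(w) ) ] equals max { J(w) : w ∈ W, r(w) = max_{v ∈ W} r(v) }. -/
open Real Filter

theorem ml_certainty_equivalence_limit
    {W : Type*} [Fintype W] [Nonempty W]
    (r : W → ℝ) (hr0 : ∀ w, 0 < r w) (hr1 : ∑ w, r w = 1)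
    (J : W → ℝ) :
    Tendsto (fun γH : ℝ =>
        (⨆ w, (γH * Real.log (r w) + J w)) - γH * Real.log (⨆ w, r w))
      atTop (nhds (sSup (J '' {w | r w = ⨆ v, r v}))) := by
  set M := ⨆ v, r v with hM
  set S := J '' {w | r w = M} with hS
  have hfin : S.Finite := Set.toFinite S
  have hne : S.Nonempty := by
    obtain ⟨w, hw⟩ := exists_eq_ciSup_of_finite (f := r)
    exact ⟨J w, w, hw, rfl⟩
  obtain ⟨w₀, hw₀, hJ⟩ := hne.csSup_mem hfin
  have hle : ∀ w, r w ≤ M := le_ciSup (Set.finite_range r).bddAbove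
  have key : ∀ᶠ γ : ℝ in atTop, ∀ w, γ * Real.log (r w) + J w ≤ γ * Real.log M + sSup S := by
    refine eventually_all.2 fun w => ?_
    rcases (hle w).eq_or_lt with h | h
    · refine Eventually.of_forall fun γ => ?_
      rw [h]
      gcongr
      exact le_csSup hfin.bddAbove ⟨w, h, rfl⟩
    · have hlog : 0 < Real.log M - Real.log (r w) := sub_pos.2 (Real.log_lt_log (hr0 w) h)
      filter_upwards [(tendsto_id.atTop_mul_const hlog).eventually_ge_atTop (J w - sSup S)]
        with γ hγ
      simp only [id] at hγ
      linarith
  refine tendsto_const_nhds.congr' ?_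
  filter_upwards [key] with γ hγ
  have hsup : (⨆ w, (γ * Real.log (r w) + J w)) = γ * Real.log M + sSup S := by
    refine le_antisymm (ciSup_le hγ) ?_
    have h := le_ciSup (f := fun w => γ * Real.log (r w) + J w) (Set.finite_range _).bddAbove w₀
    have hr : r w₀ = M := hw₀
    simpa only [hr, hJ] using h
  rw [hsup]
  ring
end

section
/- Let P be a real symmetric n × n matrix, D a real n × m matrix, ξ ∈ ℝⁿ, and γ_H > 0 such that M = γ_H·I − 2·DᵀPD is positive definite. Then the supremum over w ∈ ℝᵐ of [ −(γ_H/2)·wᵀw + (ξ + Dw)ᵀP(ξ + Dw) ] equals ξᵀPξ + 2·ξᵀPD·M⁻¹·DᵀPξ, and it is attained uniquely at w* = M⁻¹·(2·DᵀPξ). -/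
open Matrix

/-- Completing the square for a symmetric matrix `M` around a solution `c` of `M c = 2 b`. -/
theorem complete_square_of_mulVec_eq {ι : Type*} [Fintype ι] {M : Matrix ι ι ℝ}
    (hM : M.IsSymm) {b c : ι → ℝ} (hc : M *ᵥ c = (2 : ℝ) • b) (w : ι → ℝ) :
    2 * (w ⬝ᵥ b) - 1 / 2 * (w ⬝ᵥ M *ᵥ w) =
      c ⬝ᵥ b - 1 / 2 * ((w - c) ⬝ᵥ M *ᵥ (w - c)) := by
  have hcw : c ⬝ᵥ M *ᵥ w = w ⬝ᵥ M *ᵥ c := by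
    rw [dotProduct_mulVec, ← mulVec_transpose, hM.eq, dotProduct_comm]
  rw [mulVec_sub, dotProduct_sub, sub_dotProduct, sub_dotProduct, hcw, hc]
  simp only [dotProduct_smul, smul_eq_mul]
  ring

/-- The quadratic expansion of a soft-constrained objective in the disturbance `w`. -/
theorem soft_constrained_objective_eq {ι κ : Type*} [Fintype ι] [Fintype κ] [DecidableEq κ]
    {P : Matrix ι ι ℝ} (hP : P.IsSymm) (D : Matrix ι κ ℝ) (ξ : ι → ℝ) (γ : ℝ) (w : κ → ℝ) :
    -(γ / 2) * (w ⬝ᵥ w) + (ξ + D *ᵥ w) ⬝ᵥ P *ᵥ (ξ + D *ᵥ w) =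
      ξ ⬝ᵥ P *ᵥ ξ + (2 * (w ⬝ᵥ (Dᵀ * P) *ᵥ ξ) -
        1 / 2 * (w ⬝ᵥ (γ • (1 : Matrix κ κ ℝ) - (2 : ℝ) • (Dᵀ * P * D)) *ᵥ w)) := by
  have hD (v : ι → ℝ) : w ⬝ᵥ Dᵀ *ᵥ v = (D *ᵥ w) ⬝ᵥ v := by
    rw [dotProduct_mulVec, vecMul_transpose]
  have hξ : ξ ⬝ᵥ P *ᵥ D *ᵥ w = (D *ᵥ w) ⬝ᵥ P *ᵥ ξ := by
    rw [dotProduct_mulVec, ← mulVec_transpose, hP.eq, dotProduct_comm]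
  simp only [sub_mulVec, smul_mulVec, one_mulVec, ← mulVec_mulVec, mulVec_add, dotProduct_add,
    add_dotProduct, dotProduct_sub, dotProduct_smul, smul_eq_mul, hD, hξ]
  ring

theorem soft_constrained_lq_inner_max
    (n m : ℕ)
    (P : Matrix (Fin n) (Fin n) ℝ) (hP : P.IsSymm)
    (D : Matrix (Fin n) (Fin m) ℝ) (ξ : Fin n → ℝ)
    (γH : ℝ) (hγH : 0 < γH)
    (M : Matrix (Fin m) (Fin m) ℝ)
    (hM : M = γH • (1 : Matrix (Fin m) (Fin m) ℝ) - (2 : ℝ) • (Dᵀ * P * D))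
    (hMpd : M.PosDef)
    (wstar : Fin m → ℝ)
    (hwstar : wstar = M⁻¹.mulVec ((2 : ℝ) • (Dᵀ * P).mulVec ξ))
    (V : ℝ)
    (hV : V = ξ ⬝ᵥ P.mulVec ξ + 2 * (ξ ⬝ᵥ (P * D * M⁻¹ * Dᵀ * P).mulVec ξ)) :
    (∀ w : Fin m → ℝ,
        -(γH / 2) * (w ⬝ᵥ w)
          + (ξ + D.mulVec w) ⬝ᵥ P.mulVec (ξ + D.mulVec w) ≤ V) ∧
    (-(γH / 2) * (wstar ⬝ᵥ wstar)
        + (ξ + D.mulVec wstar) ⬝ᵥ P.mulVec (ξ + D.mulVec wstar) = V) ∧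
    (∀ w : Fin m → ℝ,
        -(γH / 2) * (w ⬝ᵥ w)
          + (ξ + D.mulVec w) ⬝ᵥ P.mulVec (ξ + D.mulVec w) = V →
        w = wstar) := by
  have hsymm : M.IsSymm := by simpa using hMpd.isHermitian
  have hc : M *ᵥ wstar = (2 : ℝ) • (Dᵀ * P) *ᵥ ξ := by
    rw [hwstar, mulVec_mulVec, M.mul_nonsing_inv ((isUnit_iff_isUnit_det M).mp hMpd.isUnit),
      one_mulVec]
  have hVc : V = ξ ⬝ᵥ P *ᵥ ξ + wstar ⬝ᵥ (Dᵀ * P) *ᵥ ξ := by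
    have hb : ξ ᵥ* (P * D) = (Dᵀ * P) *ᵥ ξ := by
      rw [← mulVec_transpose, transpose_mul, hP.eq]
    have hassoc : P * D * M⁻¹ * Dᵀ * P = P * D * (M⁻¹ * (Dᵀ * P)) := by
      simp only [Matrix.mul_assoc]
    rw [hV, hwstar, hassoc, ← mulVec_mulVec, dotProduct_mulVec ξ (P * D), hb, ← mulVec_mulVec ξ M⁻¹,
      mulVec_smul, smul_dotProduct, smul_eq_mul, dotProduct_comm (M⁻¹ *ᵥ _)]
  have key (w : Fin m → ℝ) :
      -(γH / 2) * (w ⬝ᵥ w) + (ξ + D *ᵥ w) ⬝ᵥ P *ᵥ (ξ + D *ᵥ w) =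
        V - 1 / 2 * ((w - wstar) ⬝ᵥ M *ᵥ (w - wstar)) := by
    rw [soft_constrained_objective_eq hP, ← hM, complete_square_of_mulVec_eq hsymm hc, hVc]
    ring
  refine ⟨fun w => ?_, ?_, fun w hw => ?_⟩
  · have h := hMpd.posSemidef.dotProduct_mulVec_nonneg (w - wstar)
    rw [star_trivial] at h
    rw [key]
    linarith
  · rw [key]
    simp
  · by_contra hne
    have h := hMpd.dotProduct_mulVec_pos (sub_ne_zero.mpr hne)
    rw [star_trivial] at h
    rw [key] at hw
    linarith
end

section
/- Let P be a real symmetric n × n matrix, D a real n × m matrix, ξ ∈ ℝⁿ, γ_H > 0, γ_E > 0, and suppose M = γ_H·I − 2·DᵀPD is positive definite. Define α(w) = γ_H·log( (2π)^{−m/2}·exp(−‖w‖²/2) ) + (ξ + Dw)ᵀP(ξ + Dw) for w ∈ ℝᵐ. Then γ_E·log ∫_{ℝᵐ} exp(α(w)/γ_E) dw = ξᵀ( P + 2·PD·M⁻¹·DᵀP )ξ + (γ_E − γ_H)·(m/2)·log(2π) − (γ_E/2)·log( det M / γ_E^{m} ). -/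
open Matrix Real MeasureTheory

/-- The centred Gaussian integral attached to a matrix with a square factorization. -/
theorem integral_exp_neg_mul_dotProduct_transpose_mul_self {ι : Type*} [Fintype ι] [DecidableEq ι]
    (A : Matrix ι ι ℝ) (hA : A.det ≠ 0) (b : ℝ) :
    ∫ x : ι → ℝ, Real.exp (-b * (x ⬝ᵥ (Aᵀ * A) *ᵥ x)) =
      |A.det|⁻¹ * √(π / b) ^ Fintype.card ι := by
  have hquad (x : ι → ℝ) : x ⬝ᵥ (Aᵀ * A) *ᵥ x = (A *ᵥ x) ⬝ᵥ (A *ᵥ x) := by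
    rw [← mulVec_mulVec, dotProduct_mulVec, vecMul_transpose]
  have hmap := Real.map_matrix_volume_pi_eq_smul_volume_pi hA
  have hcont : Continuous fun y : ι → ℝ => Real.exp (-b * (y ⬝ᵥ y)) := by fun_prop
  have hchange := integral_map (μ := (volume : Measure (ι → ℝ)))
    (φ := Matrix.toLin' A) (f := fun y : ι → ℝ => Real.exp (-b * (y ⬝ᵥ y)))
    (LinearMap.continuous_of_finiteDimensional _).aemeasurable hcont.aestronglyMeasurable
  have hprod : ∫ y : ι → ℝ, Real.exp (-b * (y ⬝ᵥ y)) = √(π / b) ^ Fintype.card ι := by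
    rw [← integral_gaussian b, ← integral_fintype_prod_volume_eq_pow]
    refine integral_congr_ae (.of_forall fun y => ?_)
    simp only [dotProduct, Finset.mul_sum, Real.exp_sum, sq]
  simp only [hquad]
  simp only [toLin'_apply] at hchange
  rw [← hchange, hmap, integral_smul_measure, hprod, smul_eq_mul,
    ENNReal.toReal_ofReal (abs_nonneg _), abs_inv]

theorem Matrix.PosDef.integral_exp_neg_mul_dotProduct_mulVec {ι : Type*} [Fintype ι] [DecidableEq ι]
    {M : Matrix ι ι ℝ} (hM : M.PosDef) (b : ℝ) :
    ∫ x : ι → ℝ, Real.exp (-b * (x ⬝ᵥ M *ᵥ x)) =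
      (√M.det)⁻¹ * √(π / b) ^ Fintype.card ι := by
  obtain ⟨A, rfl⟩ : ∃ A : Matrix ι ι ℝ, M = Aᵀ * A := by
    open scoped MatrixOrder in
    obtain ⟨A, hA⟩ := CStarAlgebra.nonneg_iff_eq_star_mul_self.mp hM.posSemidef.nonneg
    exact ⟨A, by rw [hA, star_eq_conjTranspose, conjTranspose_eq_transpose_of_trivial]⟩
  have hdet : (Aᵀ * A).det = A.det ^ 2 := by rw [det_mul, det_transpose, sq]
  have hA : A.det ≠ 0 := fun h => by
    have := hM.det_pos
    simp [hdet, h] at this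
  rw [integral_exp_neg_mul_dotProduct_transpose_mul_self A hA, hdet, Real.sqrt_sq_eq_abs]

/-- Completing the square for a symmetric invertible matrix. -/
theorem Matrix.IsSymm.neg_half_dotProduct_mulVec_add_eq {ι : Type*} [Fintype ι] [DecidableEq ι]
    {M : Matrix ι ι ℝ} (hM : M.IsSymm) (hdet : IsUnit M.det) (v w : ι → ℝ) :
    -(1 / 2) * (w ⬝ᵥ M *ᵥ w) + 2 * (v ⬝ᵥ w) =
      -(1 / 2) * ((w - (2 : ℝ) • M⁻¹ *ᵥ v) ⬝ᵥ M *ᵥ (w - (2 : ℝ) • M⁻¹ *ᵥ v))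
        + 2 * (v ⬝ᵥ M⁻¹ *ᵥ v) := by
  have hinv : M *ᵥ M⁻¹ *ᵥ v = v := by
    rw [mulVec_mulVec, mul_nonsing_inv _ hdet, one_mulVec]
  have hcross : (M⁻¹ *ᵥ v) ⬝ᵥ M *ᵥ w = v ⬝ᵥ w := by
    rw [dotProduct_mulVec, ← mulVec_transpose, hM.eq, hinv]
  simp only [mulVec_sub, mulVec_smul, sub_dotProduct, dotProduct_sub, smul_dotProduct,
    dotProduct_smul, hinv, hcross, smul_eq_mul, dotProduct_comm w v,
    dotProduct_comm (M⁻¹ *ᵥ v) v]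
  ring

theorem minsoftmax_lq_gaussian_inner_value
    (n m : ℕ)
    (P : Matrix (Fin n) (Fin n) ℝ) (hP : P.IsSymm)
    (D : Matrix (Fin n) (Fin m) ℝ) (ξ : Fin n → ℝ)
    (γH γE : ℝ) (hγH : 0 < γH) (hγE : 0 < γE)
    (M : Matrix (Fin m) (Fin m) ℝ)
    (hM : M = γH • (1 : Matrix (Fin m) (Fin m) ℝ) - (2 : ℝ) • (Dᵀ * P * D))
    (hMpd : M.PosDef)
    (α : (Fin m → ℝ) → ℝ)
    (hα : ∀ w, α w =
      γH * Real.log ((2 * Real.pi) ^ (-(m : ℝ) / 2) * Real.exp (-(w ⬝ᵥ w) / 2))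
        + (ξ + D.mulVec w) ⬝ᵥ P.mulVec (ξ + D.mulVec w)) :
    γE * Real.log (∫ w : Fin m → ℝ, Real.exp (α w / γE))
      = ξ ⬝ᵥ ((P + (2 : ℝ) • (P * D * M⁻¹ * Dᵀ * P)).mulVec ξ)
        + (γE - γH) * ((m : ℝ) / 2) * Real.log (2 * Real.pi)
        - (γE / 2) * Real.log (M.det / γE ^ m) := by
  have hdet : 0 < M.det := hMpd.det_pos
  have hMsymm : M.IsSymm := by
    simpa [IsHermitian, conjTranspose_eq_transpose_of_trivial] using! hMpd.isHermitian
  set v : Fin m → ℝ := Dᵀ *ᵥ P *ᵥ ξ with hv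
  have hleft (w : Fin m → ℝ) : ξ ⬝ᵥ P *ᵥ D *ᵥ w = v ⬝ᵥ w := by
    rw [dotProduct_mulVec, dotProduct_mulVec, hv, mulVec_transpose, ← vecMul_transpose, hP.eq]
  set c : ℝ := -(γH * (m / 2) * Real.log (2 * π)) + ξ ⬝ᵥ P *ᵥ ξ + 2 * (v ⬝ᵥ M⁻¹ *ᵥ v) with hc
  have hα' (w : Fin m → ℝ) : α w / γE = c / γE + -(1 / (2 * γE)) *
      ((w - (2 : ℝ) • M⁻¹ *ᵥ v) ⬝ᵥ M *ᵥ (w - (2 : ℝ) • M⁻¹ *ᵥ v)) := by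
    have hquad : w ⬝ᵥ M *ᵥ w = γH * (w ⬝ᵥ w) - 2 * ((D *ᵥ w) ⬝ᵥ P *ᵥ D *ᵥ w) := by
      rw [hM, sub_mulVec, smul_mulVec, smul_mulVec, one_mulVec, dotProduct_sub, dotProduct_smul,
        dotProduct_smul, ← mulVec_mulVec, ← mulVec_mulVec, dotProduct_mulVec w Dᵀ,
        vecMul_transpose, smul_eq_mul, smul_eq_mul]
    have hright : (D *ᵥ w) ⬝ᵥ P *ᵥ ξ = v ⬝ᵥ w := by
      rw [dotProduct_comm v, hv, dotProduct_mulVec w Dᵀ, vecMul_transpose]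
    have hsquare := hMsymm.neg_half_dotProduct_mulVec_add_eq hdet.ne'.isUnit v w
    rw [hα, Real.log_mul (by positivity) (by positivity), Real.log_exp,
      Real.log_rpow (by positivity), mulVec_add, add_dotProduct, dotProduct_add, dotProduct_add,
      hleft, hright]
    field_simp
    linear_combination 2 * hsquare + hquad + 2 * hc
  have hint : ∫ w : Fin m → ℝ, Real.exp (α w / γE) =
      Real.exp (c / γE) * ((√M.det)⁻¹ * √(π / (1 / (2 * γE))) ^ m) := by
    simp only [hα', Real.exp_add]
    rw [integral_const_mul, integral_sub_right_eq_self
      (fun w : Fin m → ℝ => Real.exp (-(1 / (2 * γE)) * (w ⬝ᵥ M *ᵥ w))),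
      hMpd.integral_exp_neg_mul_dotProduct_mulVec, Fintype.card_fin]
  have hscale : π / (1 / (2 * γE)) = 2 * π * γE := by field_simp
  have hvalue : ξ ⬝ᵥ (P + (2 : ℝ) • (P * D * M⁻¹ * Dᵀ * P)) *ᵥ ξ =
      ξ ⬝ᵥ P *ᵥ ξ + 2 * (v ⬝ᵥ M⁻¹ *ᵥ v) := by
    rw [add_mulVec, smul_mulVec, dotProduct_add, dotProduct_smul, smul_eq_mul,
      ← mulVec_mulVec, ← mulVec_mulVec, ← mulVec_mulVec, ← mulVec_mulVec, ← hv, hleft]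
  rw [hint, hscale, hvalue, Real.log_mul (by positivity) (by positivity), Real.log_exp,
    Real.log_mul (by positivity) (by positivity), Real.log_inv, Real.log_pow,
    Real.log_sqrt hdet.le, Real.log_sqrt (by positivity),
    Real.log_mul (by positivity) hγE.ne', Real.log_div hdet.ne' (by positivity), Real.log_pow, hc]
  field_simp
  ring
end
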